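/- arXiv:1411.3747 — 3 statements merged into one kernel-verified Lean document; each statement's English description precedes it below -/
import Mathlib

section
/- Let Γ = ⟨N, (A_i), (u_i)⟩ be a finite strategic game and let Γ' = ⟨N, (A'_i), (u'_i)⟩ be super-equivalent to Γ via renaming functions ρ = (ρ_i), i.e. Γ' ≈_ρ Γ. Then for every coarse correlated equilibrium α of Γ there exists a coarse correlated equilibrium α' of Γ' such that ρ(α') = α. Concretely, the distribution α' obtained by sampling a ← α and then outputting, independently for each coordinate i, a uniformly random element of the (nonempty, finite) preimage ρ_i^{-1}(a_i), is a coarse correlated equilibrium of Γ' whose pushforward under ρ equals α. -/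
open Finset

section UniformLift

variable {ι : Type*} [Fintype ι] [DecidableEq ι]
  {A : ι → Type*} [∀ i, DecidableEq (A i)]
  {A' : ι → Type*} [∀ i, Fintype (A' i)]
  (ρ : ∀ i, A' i → A i)

/-- Choosing a uniform preimage in each coordinate has total mass one on each fiber. -/
theorem sum_fiber_prod_inv_card (hsurj : ∀ i, Function.Surjective (ρ i)) (a : ∀ i, A i) :
    ∑ a' ∈ univ.filter (fun a' : ∀ i, A' i => (fun j => ρ j (a' j)) = a),
      ∏ i, ((univ.filter (fun x : A' i => ρ i x = ρ i (a' i))).card : ℝ)⁻¹ = 1 := by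
  have hfib : univ.filter (fun a' : ∀ i, A' i => (fun j => ρ j (a' j)) = a) =
      Fintype.piFinset (fun i => univ.filter (fun x : A' i => ρ i x = a i)) := by
    ext a'
    simp [funext_iff, Fintype.mem_piFinset]
  rw [hfib, ← prod_univ_sum (fun i => univ.filter (fun x : A' i => ρ i x = a i))
    (fun i y => ((univ.filter (fun x : A' i => ρ i x = ρ i y)).card : ℝ)⁻¹)]
  refine prod_eq_one fun i _ => ?_
  have hcard : ((univ.filter (fun x : A' i => ρ i x = a i)).card : ℝ) ≠ 0 := by
    obtain ⟨x, hx⟩ := hsurj i (a i)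
    exact Nat.cast_ne_zero.2 (card_ne_zero_of_mem (mem_filter.2 ⟨mem_univ x, hx⟩))
  rw [sum_congr rfl (g := fun _ => ((univ.filter (fun x : A' i => ρ i x = a i)).card : ℝ)⁻¹)
    fun y hy => by rw [(mem_filter.1 hy).2], sum_const, nsmul_eq_mul, mul_inv_cancel₀ hcard]

/-- The lift of `α` to uniform preimages gives each fiber over `a` mass `α a`. -/
theorem sum_fiber_uniformLift (hsurj : ∀ i, Function.Surjective (ρ i))
    (α : (∀ i, A i) → ℝ) (a : ∀ i, A i) :
    ∑ a' ∈ univ.filter (fun a' : ∀ i, A' i => (fun j => ρ j (a' j)) = a),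
      α (fun j => ρ j (a' j)) *
        ∏ i, ((univ.filter (fun x : A' i => ρ i x = ρ i (a' i))).card : ℝ)⁻¹ = α a := by
  conv_rhs => rw [← mul_one (α a), ← sum_fiber_prod_inv_card ρ hsurj a, mul_sum]
  exact sum_congr rfl fun a' ha' => by rw [(mem_filter.1 ha').2]

/-- Expectations of functions of the renamed profile agree under `α` and its lift. -/
theorem sum_uniformLift_mul [∀ i, Fintype (A i)] (hsurj : ∀ i, Function.Surjective (ρ i))
    (α g : (∀ i, A i) → ℝ) :
    ∑ a' : ∀ i, A' i, (α (fun j => ρ j (a' j)) *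
        ∏ i, ((univ.filter (fun x : A' i => ρ i x = ρ i (a' i))).card : ℝ)⁻¹) *
          g (fun j => ρ j (a' j)) = ∑ a, α a * g a := by
  rw [← sum_fiberwise univ (fun (a' : ∀ i, A' i) j => ρ j (a' j))]
  refine sum_congr rfl fun a _ => ?_
  rw [← sum_fiber_uniformLift ρ hsurj α a, sum_mul]
  exact sum_congr rfl fun a' ha' => by rw [(mem_filter.1 ha').2]

end UniformLift

/-- For a game Γ' super-equivalent to Γ via renaming functions ρ,
every coarse correlated equilibrium α of Γ lifts to a coarse correlated equilibrium α'
of Γ' (obtained by sampling a ← α and picking a uniform preimage in each coordinate)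
whose pushforward under ρ equals α. -/
theorem cce_lifts_along_superequivalence
    {ι : Type*} [Fintype ι] [DecidableEq ι]
    {A : ι → Type*} [∀ i, Fintype (A i)] [∀ i, DecidableEq (A i)]
    {A' : ι → Type*} [∀ i, Fintype (A' i)] [∀ i, DecidableEq (A' i)]
    (u : ι → (∀ i, A i) → ℝ) (u' : ι → (∀ i, A' i) → ℝ)
    (ρ : ∀ i, A' i → A i)
    (hsurj : ∀ i, Function.Surjective (ρ i))
    (hequiv : ∀ i (a' : ∀ j, A' j), u' i a' = u i (fun j => ρ j (a' j)))
    (α : (∀ i, A i) → ℝ)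
    (hα0 : ∀ a, 0 ≤ α a) (hα1 : ∑ a, α a = 1)
    (hCCE : ∀ i (aᵢ : A i),
      ∑ a, α a * u i (Function.update a i aᵢ) ≤ ∑ a, α a * u i a) :
    -- the concrete lifted distribution α'
    let α' : (∀ i, A' i) → ℝ := fun a' =>
      α (fun j => ρ j (a' j)) *
        ∏ i, ((univ.filter (fun x : A' i => ρ i x = ρ i (a' i))).card : ℝ)⁻¹
    -- α' is a probability distribution
    (∀ a', 0 ≤ α' a') ∧ (∑ a', α' a' = 1) ∧
    -- α' is a coarse correlated equilibrium of Γ'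
    (∀ i (aᵢ' : A' i),
      ∑ a', α' a' * u' i (Function.update a' i aᵢ') ≤ ∑ a', α' a' * u' i a') ∧
    -- the pushforward of α' under ρ equals α
    (∀ a : ∀ i, A i,
      ∑ a' ∈ univ.filter (fun a' : ∀ i, A' i => (fun j => ρ j (a' j)) = a), α' a'
        = α a) := by
  intro α'
  refine ⟨fun a' => mul_nonneg (hα0 _) (prod_nonneg fun i _ => by positivity), ?_, ?_,
    sum_fiber_uniformLift ρ hsurj α⟩
  · simpa [α', hα1] using sum_uniformLift_mul ρ hsurj α fun _ => 1
  · intro i aᵢ'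
    have hupd (a' : ∀ j, A' j) : (fun j => ρ j (Function.update a' i aᵢ' j)) =
        Function.update (fun j => ρ j (a' j)) i (ρ i aᵢ') :=
      funext fun j => Function.apply_update ρ a' i aᵢ' j
    simp only [hequiv, hupd, α']
    rw [sum_uniformLift_mul ρ hsurj α (u i),
      sum_uniformLift_mul ρ hsurj α fun a => u i (Function.update a i (ρ i aᵢ'))]
    exact hCCE i (ρ i aᵢ')
end

section
/- Let Σ = (SGen, SEnc, SDec) be a (deterministic, finite) secret-key encryption scheme over message space M with ciphertext space C such that |C| ≥ 3 and such that for every key sk the encryption map SEnc_sk : M → C is a bijection (equivalently, since correctness makes SEnc_sk injective, |M| = |C|). If Σ is perfectly non-malleable, then Σ is perfectly secure: for all messages m_0, m_1 ∈ M and every ciphertext c ∈ C, Pr_{sk←SGen}[SDec_sk(c) = m_0] = Pr_{sk←SGen}[SDec_sk(c) = m_1]. -/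
open Finset

/-- If a (deterministic, finite) secret-key encryption scheme with at least
three ciphertexts and bijective per-key encryption maps is perfectly non-malleable, then
it is perfectly secure. -/
theorem perfectly_nonmalleable_implies_perfectly_secure
    {K M C : Type*} [Fintype K] [Fintype M] [Fintype C]
    [DecidableEq M] [DecidableEq C]
    (gen : K → ℝ) (hgen0 : ∀ sk, 0 ≤ gen sk) (hgen1 : ∑ sk, gen sk = 1)
    (SEnc : K → M → C) (SDec : K → C → M)
    (hcorr : ∀ (sk : K) (m : M), SDec sk (SEnc sk m) = m)
    (hcard : 3 ≤ Fintype.card C)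
    (hbij : ∀ sk : K, Function.Bijective (SEnc sk))
    -- perfect non-malleability
    (hNM : ∀ (c c' c'' : C), c' ≠ c → c'' ≠ c → ∀ R : M → M → Bool,
      ∑ sk ∈ univ.filter (fun sk : K => R (SDec sk c) (SDec sk c') = true), gen sk
        = ∑ sk ∈ univ.filter (fun sk : K => R (SDec sk c) (SDec sk c'') = true), gen sk) :
    -- perfect security
    ∀ (m₀ m₁ : M) (c : C),
      ∑ sk ∈ univ.filter (fun sk : K => SDec sk c = m₀), gen sk
        = ∑ sk ∈ univ.filter (fun sk : K => SDec sk c = m₁), gen sk := by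
  intro m₀ m₁ c
  obtain rfl | hm := eq_or_ne m₀ m₁
  · rfl
  have hdec : ∀ sk x m, SDec sk x = m ↔ x = SEnc sk m := by
    intro sk x m
    obtain ⟨n, rfl⟩ := (hbij sk).2 x
    rw [hcorr, (hbij sk).1.eq_iff]
  let P : C → C → M → M → ℝ := fun x y a b =>
    ∑ sk, if SDec sk x = a ∧ SDec sk y = b then gen sk else 0
  have hP_swap : ∀ x y a b, P x y a b = P y x b a := fun x y a b => by
    simp only [P, and_comm]
  have hP_indep : ∀ x y z, y ≠ x → z ≠ x → ∀ a b, P x y a b = P x z a b := by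
    intro x y z hy hz a b
    simpa [P, Finset.sum_filter] using hNM x y z hy hz (fun u v => decide (u = a ∧ v = b))
  -- For each `sk` with `SDec sk c = a`, any `b ≠ a` is the decryption of exactly one ciphertext other than `c`.
  have hmarginal : ∀ a b, a ≠ b →
      ∑ sk ∈ univ.filter (fun sk : K => SDec sk c = a), gen sk
        = ∑ y ∈ univ.erase c, P c y a b := by
    intro a b hab
    simp only [P]
    rw [Finset.sum_comm, Finset.sum_filter]
    refine Finset.sum_congr rfl fun sk _ => ?_
    by_cases h : SDec sk c = a
    · have hne : SEnc sk b ≠ c := by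
        intro hc
        exact hab (by rw [← h, ← hc, hcorr])
      simp [h, hdec sk _ b, hne]
    · simp [h]
  rw [hmarginal m₀ m₁ hm, hmarginal m₁ m₀ hm.symm]
  refine Finset.sum_congr rfl fun y hy => ?_
  have hyc : y ≠ c := Finset.ne_of_mem_erase hy
  obtain ⟨z, hz⟩ : ∃ z, z ∉ ({c, y} : Finset C) := by
    by_contra! h
    have h₁ : Fintype.card C ≤ ({c, y} : Finset C).card :=
      Finset.card_le_card fun x _ => h x
    have h₂ : ({c, y} : Finset C).card ≤ 2 := Finset.card_le_two
    omega
  simp only [Finset.mem_insert, Finset.mem_singleton, not_or] at hz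
  obtain ⟨hzc, hzy⟩ := hz
  calc P c y m₀ m₁ = P y c m₁ m₀ := hP_swap _ _ _ _
    _ = P y z m₁ m₀ := hP_indep _ _ _ hyc.symm hzy _ _
    _ = P z y m₀ m₁ := hP_swap _ _ _ _
    _ = P z c m₀ m₁ := hP_indep _ _ _ (Ne.symm hzy) (Ne.symm hzc) _ _
    _ = P c z m₁ m₀ := hP_swap _ _ _ _
    _ = P c y m₁ m₀ := hP_indep _ _ _ hzc hyc _ _
end

section
/- Let Σ = (SGen, SEnc, SDec) be a (deterministic, finite) secret-key encryption scheme over message space M such that for all m_0, m_1 ∈ M and every c ∈ C: Pr_{sk←SGen}[SEnc_sk(m_0) = c] = Pr_{sk←SGen}[SEnc_sk(m_1) = c]. Let Γ = ⟨N, (A_i), (u_i)⟩ be a finite strategic game with A_i ⊆ M for all i, and let α be any probability distribution on ∏_{j∈N} A_j. Consider the joint random experiment in which sk ← SGen and a ← α are sampled independently and player i's encrypted advice is set to c_i = SEnc_sk(a_i). Then for every player i, the random ciphertext c_i is independent of the action profile a; consequently, for every player i and every ciphertext b ∈ C occurring with positive probability as c_i, the conditional expectation satisfies E[u_i(a) |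 c_i = b] = E_{a←α}[u_i(a)], so in particular the conditional expected utility is the same for any two ciphertext values of the advice. -/
open Finset

/-- If the ciphertext distribution of the scheme is independent of the
message, then in the joint experiment (sk ← SGen independent of a ← α, advice
c_i = SEnc_sk(a_i)) each player's encrypted advice c_i is independent of the action
profile a, and the conditional expected utility given any positive-probability advice
value equals the unconditional expected utility. -/
theorem encrypted_advice_independent_of_profile
    {ι K M C : Type*} [Fintype ι] [DecidableEq ι]
    [Fintype K] [Fintype M] [Fintype C] [DecidableEq M] [DecidableEq C]
    (gen : K → ℝ) (hgen0 : ∀ sk, 0 ≤ gen sk) (hgen1 : ∑ sk, gen sk = 1)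
    (SEnc : K → M → C) (SDec : K → C → M)
    (hcorr : ∀ (sk : K) (m : M), SDec sk (SEnc sk m) = m)
    -- ciphertext distribution independent of the message
    (henc : ∀ (m₀ m₁ : M) (c : C),
      ∑ sk ∈ univ.filter (fun sk : K => SEnc sk m₀ = c), gen sk
        = ∑ sk ∈ univ.filter (fun sk : K => SEnc sk m₁ = c), gen sk)
    (A : ι → Finset M)
    (α : (∀ j, {x // x ∈ A j}) → ℝ)
    (hα0 : ∀ a, 0 ≤ α a) (hα1 : ∑ a, α a = 1)
    (u : ι → (∀ j, {x // x ∈ A j}) → ℝ) :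
    ∀ i : ι,
      -- the advice c_i is independent of the profile a:
      -- Pr[c_i = b ∧ a = a₀] = Pr[c_i = b] · Pr[a = a₀]
      (∀ (b : C) (a₀ : ∀ j, {x // x ∈ A j}),
        (∑ sk ∈ univ.filter (fun sk : K => SEnc sk (a₀ i : M) = b), gen sk) * α a₀
          = (∑ a, α a * ∑ sk ∈ univ.filter (fun sk : K => SEnc sk (a i : M) = b), gen sk)
              * α a₀) ∧
      -- the conditional expected utility given advice b equals the unconditional one
      (∀ b : C,
        0 < ∑ a, α a * ∑ sk ∈ univ.filter (fun sk : K => SEnc sk (a i : M) = b), gen sk →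
        (∑ a, (α a * ∑ sk ∈ univ.filter (fun sk : K => SEnc sk (a i : M) = b), gen sk)
            * u i a) /
          (∑ a, α a * ∑ sk ∈ univ.filter (fun sk : K => SEnc sk (a i : M) = b), gen sk)
          = ∑ a, α a * u i a) := by
  intro i
  have hmix (b : C) (m : M) :
      ∑ a, α a * ∑ sk ∈ univ.filter (fun sk : K => SEnc sk (a i : M) = b), gen sk
        = ∑ sk ∈ univ.filter (fun sk : K => SEnc sk m = b), gen sk := by
    rw [Finset.sum_congr rfl fun a _ => congrArg (α a * ·) (henc (a i) m b),
      ← Finset.sum_mul, hα1, one_mul]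
  refine ⟨fun b a₀ => by rw [hmix b (a₀ i)], fun b hb => ?_⟩
  rw [div_eq_iff hb.ne', Finset.sum_mul]
  refine Finset.sum_congr rfl fun a _ => ?_
  rw [hmix b (a i)]
  ring
end
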